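/- (Uniform stability of the supervised loss, main-text form.) Under the assumptions of the appendix stability bound, assume additionally that λ and λ′ lie in the probability simplex, i.e., λ_m ≥ 0, λ′_m ≥ 0, ∑_m λ_m = 1 and ∑_m λ′_m = 1. Then |φ(W_Cᵀ g) − φ(W′_Cᵀ g′)| ≤ η with η = (τ/√n) ρ^L β̂_W^{L−1} β_X (1 + β_A)^L (1 + α)^{−L} [ β̂_W γ_{ΔC} + γ_C ( 2 β̂_W + L β̂_{ΔW} ) ]. -/

import Mathlib

open Matrix BigOperators Finset

noncomputable def specNorm {m n : Type*} [Fintype m] [Fintype n] [DecidableEq n]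
    (A : Matrix m n ℝ) : ℝ :=
  ‖LinearMap.toContinuousLinearMap (Matrix.toEuclideanLin A)‖

noncomputable def frobNorm {m n : Type*} [Fintype m] [Fintype n] (A : Matrix m n ℝ) : ℝ :=
  Real.sqrt (∑ i, ∑ j, (A i j) ^ 2)

noncomputable def vecNorm {ι : Type*} [Fintype ι] (v : ι → ℝ) : ℝ :=
  Real.sqrt (∑ i, (v i) ^ 2)

noncomputable def normAdj {v : Type*} [Fintype v] [DecidableEq v]
    (A : Matrix v v ℝ) : Matrix v v ℝ :=
  Matrix.diagonal (fun i => (Real.sqrt (∑ j, (1 + A) i j))⁻¹) * (1 + A) *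
    Matrix.diagonal (fun i => (Real.sqrt (∑ j, (1 + A) i j))⁻¹)

noncomputable def deltaD {v : Type*} [Fintype v] [DecidableEq v]
    (A ΔA : Matrix v v ℝ) : Matrix v v ℝ :=
  1 - Matrix.diagonal (fun i => Real.sqrt (∑ j, (1 + (A + ΔA)) i j)) *
      Matrix.diagonal (fun i => (Real.sqrt (∑ j, (1 + A) i j))⁻¹)

noncomputable def gcn {v : Type*} [Fintype v] (U : Matrix v v ℝ) (σ : ℝ → ℝ)
    {d : ℕ → ℕ} (W : (l : ℕ) → Matrix (Fin (d l)) (Fin (d (l + 1))) ℝ)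
    (X0 : Matrix v (Fin (d 0)) ℝ) : (l : ℕ) → Matrix v (Fin (d l)) ℝ
  | 0 => X0
  | l + 1 => (U * gcn U σ W X0 l * W l).map σ

noncomputable def avgPool {v p : Type*} [Fintype v] [Fintype p]
    (X : Matrix v p ℝ) : p → ℝ :=
  fun j => (∑ i, X i j) / (Fintype.card v : ℝ)

noncomputable def ensembleRep {n M : ℕ} {d : ℕ → ℕ} (A : Matrix (Fin n) (Fin n) ℝ)
    (σ : ℝ → ℝ) (W : Fin M → (l : ℕ) → Matrix (Fin (d l)) (Fin (d (l + 1))) ℝ)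
    (X : Matrix (Fin n) (Fin (d 0)) ℝ) (lam : Fin M → ℝ) (L : ℕ) : Fin (d L) → ℝ :=
  fun j => ∑ m, lam m * avgPool (gcn (normAdj A) σ (W m) X L) j

def principalSub {n : ℕ} (A : Matrix (Fin n) (Fin n) ℝ) (s : Finset (Fin n)) :
    Matrix s s ℝ :=
  A.submatrix (fun i => (i : Fin n)) (fun j => (j : Fin n))

def rowSub {n p : ℕ} (X : Matrix (Fin n) (Fin p) ℝ) (s : Finset (Fin n)) :
    Matrix s (Fin p) ℝ :=
  X.submatrix (fun i => (i : Fin n)) id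
section VecNorm

variable {ι κ : Type*} [Fintype ι] [Fintype κ]

lemma vecNorm_eq_norm (v : ι → ℝ) : vecNorm v = ‖(WithLp.toLp 2 v : EuclideanSpace ℝ ι)‖ := by
  simp [vecNorm, EuclideanSpace.norm_eq]

lemma vecNorm_nonneg (v : ι → ℝ) : 0 ≤ vecNorm v := Real.sqrt_nonneg _

lemma vecNorm_sq (v : ι → ℝ) : vecNorm v ^ 2 = ∑ i, v i ^ 2 :=
  Real.sq_sqrt (sum_nonneg fun _ _ => sq_nonneg _)

lemma vecNorm_add_le (v w : ι → ℝ) : vecNorm (v + w) ≤ vecNorm v + vecNorm w := by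
  simp only [vecNorm_eq_norm, WithLp.toLp_add]
  exact norm_add_le _ _

lemma vecNorm_sub_le (v w : ι → ℝ) : vecNorm (v - w) ≤ vecNorm v + vecNorm w := by
  simp only [vecNorm_eq_norm, WithLp.toLp_sub]
  exact norm_sub_le _ _

lemma vecNorm_sum_smul_le {c : κ → ℝ} (hc : ∀ k, 0 ≤ c k) (z : κ → ι → ℝ) :
    vecNorm (∑ k, c k • z k) ≤ ∑ k, c k * vecNorm (z k) := by
  simp only [vecNorm_eq_norm, WithLp.toLp_sum, WithLp.toLp_smul]
  refine (norm_sum_le _ _).trans (sum_le_sum fun k _ => ?_)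
  rw [norm_smul, Real.norm_of_nonneg (hc k)]

lemma vecNorm_convexCombination_le {c : κ → ℝ} (hc : ∀ k, 0 ≤ c k) (hsum : ∑ k, c k = 1)
    {z : κ → ι → ℝ} {b : ℝ} (hz : ∀ k, vecNorm (z k) ≤ b) :
    vecNorm (∑ k, c k • z k) ≤ b := by
  calc vecNorm (∑ k, c k • z k) ≤ ∑ k, c k * vecNorm (z k) := vecNorm_sum_smul_le hc z
    _ ≤ ∑ k, c k * b := sum_le_sum fun k _ => mul_le_mul_of_nonneg_left (hz k) (hc k)
    _ = b := by rw [← sum_mul, hsum, one_mul]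

lemma vecNorm_le_mul_of_abs_le {v w : ι → ℝ} {c : ℝ} (hc : 0 ≤ c)
    (h : ∀ i, |v i| ≤ c * |w i|) : vecNorm v ≤ c * vecNorm w := by
  refine le_of_sq_le_sq ?_ (mul_nonneg hc (vecNorm_nonneg _))
  rw [mul_pow, vecNorm_sq, vecNorm_sq, mul_sum]
  refine sum_le_sum fun i _ => ?_
  rw [← sq_abs (v i), ← sq_abs (w i), ← mul_pow]
  exact pow_le_pow_left₀ (abs_nonneg _) (h i) 2

lemma frobNorm_eq_vecNorm (A : Matrix ι κ ℝ) :
    frobNorm A = vecNorm (fun p : ι × κ => A p.1 p.2) := by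
  simp [frobNorm, vecNorm, Fintype.sum_prod_type]

lemma frobNorm_nonneg (A : Matrix ι κ ℝ) : 0 ≤ frobNorm A := Real.sqrt_nonneg _

lemma frobNorm_add_le (A B : Matrix ι κ ℝ) : frobNorm (A + B) ≤ frobNorm A + frobNorm B := by
  simp only [frobNorm_eq_vecNorm]
  exact vecNorm_add_le _ _

lemma frobNorm_sq_eq_sum_rows (A : Matrix ι κ ℝ) : frobNorm A ^ 2 = ∑ i, vecNorm (A i) ^ 2 := by
  simp only [frobNorm_eq_vecNorm, vecNorm_sq, Fintype.sum_prod_type]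

lemma frobNorm_transpose (A : Matrix ι κ ℝ) : frobNorm Aᵀ = frobNorm A := by
  simp only [frobNorm, transpose_apply]
  rw [sum_comm]

lemma frobNorm_map_sub_map_le {σ : ℝ → ℝ} {ρ : ℝ} (hρ : 0 ≤ ρ)
    (hσ : ∀ a b : ℝ, |σ a - σ b| ≤ ρ * |a - b|) (P Q : Matrix ι κ ℝ) :
    frobNorm (P.map σ - Q.map σ) ≤ ρ * frobNorm (P - Q) := by
  simp only [frobNorm_eq_vecNorm]
  exact vecNorm_le_mul_of_abs_le hρ fun p => hσ _ _

lemma frobNorm_map_le {σ : ℝ → ℝ} {ρ : ℝ} (hρ : 0 ≤ ρ)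
    (hσ : ∀ a b : ℝ, |σ a - σ b| ≤ ρ * |a - b|) (hσ0 : σ 0 = 0) (P : Matrix ι κ ℝ) :
    frobNorm (P.map σ) ≤ ρ * frobNorm P := by
  simpa [hσ0] using frobNorm_map_sub_map_le hρ hσ P 0

lemma vecNorm_avgPool_le (X : Matrix ι κ ℝ) :
    vecNorm (avgPool X) ≤ frobNorm X / Real.sqrt (Fintype.card ι) := by
  refine le_of_sq_le_sq ?_ (div_nonneg (frobNorm_nonneg _) (Real.sqrt_nonneg _))
  rw [div_pow, Real.sq_sqrt (Nat.cast_nonneg _), vecNorm_sq, ← frobNorm_transpose,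
    frobNorm_sq_eq_sum_rows, sum_div]
  refine sum_le_sum fun j _ => ?_
  rw [vecNorm_sq]
  rcases (Nat.cast_nonneg (α := ℝ) (Fintype.card ι)).eq_or_lt with h | h
  · simp [avgPool, ← h]
  · rw [avgPool, div_pow, div_le_div_iff₀ (by positivity) h]
    have := sq_sum_le_card_mul_sum_sq (s := (univ : Finset ι)) (f := fun i => X i j)
    rw [card_univ] at this
    simp only [transpose_apply]
    nlinarith

lemma avgPool_sub (X Y : Matrix ι κ ℝ) : avgPool (X - Y) = avgPool X - avgPool Y := by
  ext j
  simp [avgPool, sub_div]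

end VecNorm

section SpecNorm

open scoped Matrix.Norms.L2Operator

variable {m n p : Type*} [Fintype m] [Fintype n] [Fintype p]

lemma specNorm_eq_norm [DecidableEq n] (A : Matrix m n ℝ) : specNorm A = ‖A‖ := rfl

lemma specNorm_nonneg [DecidableEq n] (A : Matrix m n ℝ) : 0 ≤ specNorm A := norm_nonneg _

lemma specNorm_transpose [DecidableEq m] [DecidableEq n] (A : Matrix m n ℝ) :
    specNorm Aᵀ = specNorm A := by
  rw [specNorm_eq_norm, specNorm_eq_norm, ← l2_opNorm_conjTranspose A,
    conjTranspose_eq_transpose_of_trivial]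

lemma vecNorm_mulVec_le [DecidableEq n] (A : Matrix m n ℝ) (v : n → ℝ) :
    vecNorm (A *ᵥ v) ≤ specNorm A * vecNorm v := by
  rw [vecNorm_eq_norm, vecNorm_eq_norm, specNorm_eq_norm]
  exact l2_opNorm_mulVec A (WithLp.toLp 2 v)

lemma vecNorm_vecMul_le [DecidableEq m] [DecidableEq n] (v : m → ℝ) (A : Matrix m n ℝ) :
    vecNorm (v ᵥ* A) ≤ vecNorm v * specNorm A := by
  rw [← mulVec_transpose, ← specNorm_transpose, mul_comm]
  exact vecNorm_mulVec_le _ _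

lemma frobNorm_mul_le_frobNorm_mul_specNorm [DecidableEq n] [DecidableEq p]
    (A : Matrix m n ℝ) (B : Matrix n p ℝ) :
    frobNorm (A * B) ≤ frobNorm A * specNorm B := by
  refine le_of_sq_le_sq ?_ (mul_nonneg (frobNorm_nonneg _) (specNorm_nonneg _))
  rw [mul_pow, frobNorm_sq_eq_sum_rows, frobNorm_sq_eq_sum_rows, sum_mul]
  refine sum_le_sum fun i _ => ?_
  rw [← mul_pow, Matrix.mul_apply_eq_vecMul]
  exact pow_le_pow_left₀ (vecNorm_nonneg _) (vecNorm_vecMul_le _ _) 2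

lemma frobNorm_mul_le_specNorm_mul_frobNorm [DecidableEq m] [DecidableEq n]
    (A : Matrix m n ℝ) (B : Matrix n p ℝ) :
    frobNorm (A * B) ≤ specNorm A * frobNorm B := by
  rw [← frobNorm_transpose, transpose_mul, ← frobNorm_transpose B, ← specNorm_transpose, mul_comm]
  exact frobNorm_mul_le_frobNorm_mul_specNorm _ _

lemma specNorm_diagonal_le [DecidableEq n] {v : n → ℝ} {c : ℝ} (hc : 0 ≤ c)
    (hv : ∀ i, |v i| ≤ c) : specNorm (diagonal v) ≤ c := by
  rw [specNorm_eq_norm, l2_opNorm_diagonal]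
  exact (pi_norm_le_iff_of_nonneg hc).2 hv

lemma specNorm_normAdj_le [DecidableEq n] {A : Matrix n n ℝ} {α β : ℝ} (hα : 0 ≤ α)
    (hdeg : ∀ i, α ≤ ∑ j, A i j) (hA : specNorm A ≤ β) :
    specNorm (normAdj A) ≤ (1 + β) / (1 + α) := by
  have hsum : ∀ i, 1 + α ≤ ∑ j, (1 + A) i j := fun i => by
    simpa [sum_add_distrib, one_apply] using hdeg i
  have hD : specNorm (diagonal fun i => (Real.sqrt (∑ j, (1 + A) i j))⁻¹)
      ≤ (Real.sqrt (1 + α))⁻¹ := by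
    refine specNorm_diagonal_le (by positivity) fun i => ?_
    rw [abs_of_nonneg (by positivity)]
    exact inv_anti₀ (Real.sqrt_pos.2 (by linarith)) (Real.sqrt_le_sqrt (hsum i))
  have h1 : specNorm (1 : Matrix n n ℝ) ≤ 1 := by
    rw [← diagonal_one]
    exact specNorm_diagonal_le zero_le_one fun i => by simp
  have h1A : specNorm (1 + A) ≤ 1 + β := (norm_add_le (1 : Matrix n n ℝ) A).trans (add_le_add h1 hA)
  have hβ : 0 ≤ 1 + β := (specNorm_nonneg _).trans h1A
  set D := diagonal fun i => (Real.sqrt (∑ j, (1 + A) i j))⁻¹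
  calc specNorm (normAdj A) ≤ specNorm (D * (1 + A)) * specNorm D := l2_opNorm_mul _ _
    _ ≤ specNorm D * specNorm (1 + A) * specNorm D :=
      mul_le_mul_of_nonneg_right (l2_opNorm_mul _ _) (specNorm_nonneg _)
    _ ≤ (Real.sqrt (1 + α))⁻¹ * (1 + β) * (Real.sqrt (1 + α))⁻¹ := by
      have := specNorm_nonneg D
      have := specNorm_nonneg (1 + A)
      gcongr
    _ = (1 + β) / (1 + α) := by
      have h := Real.mul_self_sqrt (show 0 ≤ 1 + α by linarith)
      rw [mul_right_comm, ← mul_inv, h, mul_comm, div_eq_mul_inv]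

end SpecNorm

section GCN

variable {v : Type*} [Fintype v] [DecidableEq v] {U : Matrix v v ℝ} {σ : ℝ → ℝ} {d : ℕ → ℕ}
  {W W' : (l : ℕ) → Matrix (Fin (d l)) (Fin (d (l + 1))) ℝ} {X : Matrix v (Fin (d 0)) ℝ}
  {L : ℕ} {ρ u βW βΔW βX : ℝ}

lemma frobNorm_gcn_le (hρ : 0 ≤ ρ) (hσ : ∀ a b : ℝ, |σ a - σ b| ≤ ρ * |a - b|) (hσ0 : σ 0 = 0)
    (hU : specNorm U ≤ u) (hW : ∀ l < L, specNorm (W l) ≤ βW) (hX : frobNorm X ≤ βX) :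
    ∀ l ≤ L, frobNorm (gcn U σ W X l) ≤ (ρ * u) ^ l * βW ^ l * βX := by
  intro l
  induction l with
  | zero => intro _; simpa [gcn] using hX
  | succ l ih =>
    intro hl
    have ih := ih (by omega)
    have hWl := hW l (by omega)
    have hu := (specNorm_nonneg _).trans hU
    have hβ := (specNorm_nonneg _).trans hWl
    have h0 := frobNorm_nonneg (gcn U σ W X l)
    calc frobNorm (gcn U σ W X (l + 1)) ≤ ρ * frobNorm (U * gcn U σ W X l * W l) :=
        frobNorm_map_le hρ hσ hσ0 _
      _ ≤ ρ * (frobNorm (U * gcn U σ W X l) * specNorm (W l)) := by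
        gcongr; exact frobNorm_mul_le_frobNorm_mul_specNorm _ _
      _ ≤ ρ * (specNorm U * frobNorm (gcn U σ W X l) * specNorm (W l)) := by
        have := specNorm_nonneg (W l)
        gcongr; exact frobNorm_mul_le_specNorm_mul_frobNorm _ _
      _ ≤ ρ * (u * ((ρ * u) ^ l * βW ^ l * βX) * βW) := by
        have := specNorm_nonneg (W l)
        have := h0.trans ih
        gcongr
      _ = (ρ * u) ^ (l + 1) * βW ^ (l + 1) * βX := by ring

lemma frobNorm_gcn_sub_gcn_le (hρ : 0 ≤ ρ) (hσ : ∀ a b : ℝ, |σ a - σ b| ≤ ρ * |a - b|)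
    (hσ0 : σ 0 = 0) (hU : specNorm U ≤ u) (hW : ∀ l < L, specNorm (W l) ≤ βW)
    (hW' : ∀ l < L, specNorm (W' l) ≤ βW) (hΔW : ∀ l < L, specNorm (W l - W' l) ≤ βΔW)
    (hX : frobNorm X ≤ βX) :
    ∀ l ≤ L, frobNorm (gcn U σ W X l - gcn U σ W' X l)
      ≤ l * (ρ * u) ^ l * βW ^ (l - 1) * βΔW * βX := by
  intro l
  induction l with
  | zero => intro _; simp [gcn, frobNorm]
  | succ l ih =>
    intro hl
    have ih := ih (by omega)
    have hWl := hW l (by omega)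
    have hΔl := hΔW l (by omega)
    have hu := (specNorm_nonneg _).trans hU
    have hβ := (specNorm_nonneg _).trans hWl
    have hX' := frobNorm_gcn_le hρ hσ hσ0 hU hW' hX l (by omega)
    set Y := gcn U σ W X l
    set Y' := gcn U σ W' X l
    have hsplit : U * Y * W l - U * Y' * W' l
        = U * ((Y - Y') * W l) + U * (Y' * (W l - W' l)) := by
      simp only [Matrix.mul_sub, Matrix.sub_mul, Matrix.mul_assoc]; abel
    calc frobNorm (gcn U σ W X (l + 1) - gcn U σ W' X (l + 1))
        ≤ ρ * frobNorm (U * Y * W l - U * Y' * W' l) := frobNorm_map_sub_map_le hρ hσ _ _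
      _ ≤ ρ * (frobNorm (U * ((Y - Y') * W l)) + frobNorm (U * (Y' * (W l - W' l)))) := by
        rw [hsplit]; gcongr; exact frobNorm_add_le _ _
      _ ≤ ρ * (specNorm U * frobNorm ((Y - Y') * W l)
            + specNorm U * frobNorm (Y' * (W l - W' l))) := by
        gcongr <;> exact frobNorm_mul_le_specNorm_mul_frobNorm _ _
      _ ≤ ρ * (u * (frobNorm (Y - Y') * specNorm (W l))
            + u * (frobNorm Y' * specNorm (W l - W' l))) := by
        have := frobNorm_nonneg ((Y - Y') * W l)
        have := frobNorm_nonneg (Y' * (W l - W' l))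
        gcongr <;> exact frobNorm_mul_le_frobNorm_mul_specNorm _ _
      _ ≤ ρ * (u * ((l * (ρ * u) ^ l * βW ^ (l - 1) * βΔW * βX) * βW)
            + u * (((ρ * u) ^ l * βW ^ l * βX) * βΔW)) := by
        have := specNorm_nonneg (W l)
        have := specNorm_nonneg (W l - W' l)
        have := (frobNorm_nonneg _).trans ih
        have := (frobNorm_nonneg _).trans hX'
        gcongr
      _ = (l + 1 : ℕ) * (ρ * u) ^ (l + 1) * βW ^ (l + 1 - 1) * βΔW * βX := by
        cases l <;> simp <;> ring

end GCN

lemma ensembleRep_eq_sum_smul {n M : ℕ} {d : ℕ → ℕ} (A : Matrix (Fin n) (Fin n) ℝ)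
    (σ : ℝ → ℝ) (W : Fin M → (l : ℕ) → Matrix (Fin (d l)) (Fin (d (l + 1))) ℝ)
    (X : Matrix (Fin n) (Fin (d 0)) ℝ) (lam : Fin M → ℝ) (L : ℕ) :
    ensembleRep A σ W X lam L = ∑ m, lam m • avgPool (gcn (normAdj A) σ (W m) X L) := by
  ext j
  simp [ensembleRep]

theorem uniform_stability_supervised_loss_simplex {n M C : ℕ} {d : ℕ → ℕ} (hn : 0 < n)
    (A : Matrix (Fin n) (Fin n) ℝ) (X : Matrix (Fin n) (Fin (d 0)) ℝ)
    (W W' : Fin M → (l : ℕ) → Matrix (Fin (d l)) (Fin (d (l + 1))) ℝ)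
    (L : ℕ) (hL : 1 ≤ L) (σ : ℝ → ℝ) (lam lam' : Fin M → ℝ)
    (WC WC' : Matrix (Fin (d L)) (Fin C) ℝ)
    (φ : (Fin C → ℝ) → ℝ)
    (α βA βX βW βΔW ρ τ γC γΔC : ℝ)
    (hsymm : A.IsSymm) (hnonneg : ∀ i j, 0 ≤ A i j)
    (hα : 0 ≤ α) (hdeg : ∀ i, α ≤ ∑ j, A i j) (hA : specNorm A ≤ βA)
    (hX : frobNorm X ≤ βX)
    (hW : ∀ m, ∀ l < L, specNorm (W m l) ≤ βW)
    (hW' : ∀ m, ∀ l < L, specNorm (W' m l) ≤ βW)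
    (hΔW : ∀ m, ∀ l < L, specNorm (W m l - W' m l) ≤ βΔW)
    (hρ : 0 ≤ ρ) (hσ : ∀ a b : ℝ, |σ a - σ b| ≤ ρ * |a - b|) (hσ0 : σ 0 = 0)
    (hγC : specNorm WC' ≤ γC) (hγΔC : specNorm (WC - WC') ≤ γΔC)
    (hτ : 0 ≤ τ)
    (hφ : ∀ u w : Fin C → ℝ, |φ u - φ w| ≤ τ * vecNorm (fun i => u i - w i))
    (hlam : ∀ m, 0 ≤ lam m) (hlam' : ∀ m, 0 ≤ lam' m)
    (hlamsum : ∑ m, lam m = 1) (hlamsum' : ∑ m, lam' m = 1) :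
    |φ (Matrix.vecMul (ensembleRep A σ W X lam L) WC)
      - φ (Matrix.vecMul (ensembleRep A σ W' X lam' L) WC')| ≤
      (τ / Real.sqrt n) * ρ ^ L * βW ^ (L - 1) * βX * (1 + βA) ^ L * ((1 + α) ^ L)⁻¹ *
        (βW * γΔC + γC * (2 * βW + (L : ℝ) * βΔW)) := by
  obtain ⟨m₀⟩ : Nonempty (Fin M) := by
    by_contra h
    rw [not_nonempty_iff] at h
    simp at hlamsum
  have hU := specNorm_normAdj_le hα hdeg hA
  set u := (1 + βA) / (1 + α) with hu_def
  have hsqrt : 0 ≤ Real.sqrt n := Real.sqrt_nonneg _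
  set z := fun m => avgPool (gcn (normAdj A) σ (W m) X L) with hz_def
  set z' := fun m => avgPool (gcn (normAdj A) σ (W' m) X L) with hz'_def
  have hz : ∀ m, vecNorm (z m) ≤ (ρ * u) ^ L * βW ^ L * βX / Real.sqrt n := fun m => by
    refine (vecNorm_avgPool_le _).trans ?_
    rw [Fintype.card_fin]
    exact div_le_div_of_nonneg_right
      (frobNorm_gcn_le hρ hσ hσ0 hU (hW m) hX L le_rfl) hsqrt
  have hzz' : ∀ m, vecNorm (z m - z' m)
      ≤ L * (ρ * u) ^ L * βW ^ (L - 1) * βΔW * βX / Real.sqrt n := fun m => by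
    rw [hz_def, hz'_def, ← avgPool_sub]
    refine (vecNorm_avgPool_le _).trans ?_
    rw [Fintype.card_fin]
    exact div_le_div_of_nonneg_right
      (frobNorm_gcn_sub_gcn_le hρ hσ hσ0 hU (hW m) (hW' m) (hΔW m) hX L le_rfl) hsqrt
  have hg : ensembleRep A σ W X lam L = ∑ m, lam m • z m := ensembleRep_eq_sum_smul ..
  have hg' : ensembleRep A σ W' X lam' L = ∑ m, lam' m • z' m := ensembleRep_eq_sum_smul ..
  set g := ensembleRep A σ W X lam L
  set g' := ensembleRep A σ W' X lam' L
  have hgb : vecNorm g ≤ (ρ * u) ^ L * βW ^ L * βX / Real.sqrt n :=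
    hg ▸ vecNorm_convexCombination_le hlam hlamsum hz
  have hgg' : vecNorm (g - g') ≤ 2 * ((ρ * u) ^ L * βW ^ L * βX / Real.sqrt n)
      + L * (ρ * u) ^ L * βW ^ (L - 1) * βΔW * βX / Real.sqrt n := by
    have hsplit : g - g' = (g - ∑ m, lam' m • z m) + ∑ m, lam' m • (z m - z' m) := by
      rw [hg']
      simp only [smul_sub, sum_sub_distrib]
      abel
    have h1 := vecNorm_convexCombination_le hlam' hlamsum' hz
    have h2 := vecNorm_convexCombination_le hlam' hlamsum' hzz'
    have h3 := vecNorm_sub_le g (∑ m, lam' m • z m)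
    have h4 := vecNorm_add_le (g - ∑ m, lam' m • z m) (∑ m, lam' m • (z m - z' m))
    rw [hsplit]
    linarith
  have hout : vecNorm (g ᵥ* WC - g' ᵥ* WC')
      ≤ vecNorm g * specNorm (WC - WC') + vecNorm (g - g') * specNorm WC' := by
    have hsplit : g ᵥ* WC - g' ᵥ* WC' = g ᵥ* (WC - WC') + (g - g') ᵥ* WC' := by
      rw [vecMul_sub, sub_vecMul]
      abel
    rw [hsplit]
    exact (vecNorm_add_le _ _).trans
      (add_le_add (vecNorm_vecMul_le _ _) (vecNorm_vecMul_le _ _))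
  refine (hφ _ _).trans ?_
  calc τ * vecNorm (g ᵥ* WC - g' ᵥ* WC')
      ≤ τ * (vecNorm g * specNorm (WC - WC') + vecNorm (g - g') * specNorm WC') := by gcongr
    _ ≤ τ * ((ρ * u) ^ L * βW ^ L * βX / Real.sqrt n * γΔC
          + (2 * ((ρ * u) ^ L * βW ^ L * βX / Real.sqrt n)
            + L * (ρ * u) ^ L * βW ^ (L - 1) * βΔW * βX / Real.sqrt n) * γC) := by
      have := specNorm_nonneg (WC - WC')
      have := specNorm_nonneg WC'
      have := (vecNorm_nonneg _).trans hgb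
      have := (vecNorm_nonneg _).trans hgg'
      gcongr
    _ = _ := by
      obtain ⟨k, rfl⟩ := Nat.exists_eq_add_of_le' hL
      rw [hu_def, mul_pow, div_pow, Nat.add_sub_cancel]
      ring
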